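/- arXiv:math/9909132 — 2 statements merged into one kernel-verified Lean document; each statement's English description precedes it below -/
import Mathlib

section
/- Let ψ be a wavelet in L²(ℝ), let U be a unitary operator on L²(ℝ) with Uⁿ ∈ C_ψ(D,T) for all n ∈ ℤ, set ψ⁽ⁱ⁾ = U^i ψ with core space V₀⁽ⁱ⁾, and let Y be the closed linear span of the union over i ∈ ℤ of the orthogonal complements (V₀⁽ⁱ⁾)^⊥. Then: (i) Y^⊥ ⊆ V₀⁽ⁱ⁾ for every i ∈ ℤ; (ii) U(Y) = Y and U(Y^⊥) = Y^⊥; (iii) T(Y) = Y and T(Y^⊥) = Y^⊥. -/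
open MeasureTheory
open scoped ComplexInnerProductSpace

noncomputable section

/-- The Hilbert space `L²(ℝ)` of square-integrable complex functions. -/
abbrev H : Type := MeasureTheory.Lp ℂ 2 (MeasureTheory.volume : MeasureTheory.Measure ℝ)

/-- The algebra of bounded operators on `L²(ℝ)`. -/
abbrev B : Type := H →L[ℂ] H

/-- `ψ` is a wavelet for the dilation `D` and translation `T` if
`{DʲTⁿψ : j, n ∈ ℤ}` is an orthonormal basis of `L²(ℝ)`. -/
def IsWavelet (D T : unitary B) (ψ : H) : Prop :=
  Orthonormal ℂ (fun p : ℤ × ℤ =>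
    ((D ^ p.1 : unitary B) : B) (((T ^ p.2 : unitary B) : B) ψ)) ∧
  (Submodule.span ℂ (Set.range fun p : ℤ × ℤ =>
    ((D ^ p.1 : unitary B) : B) (((T ^ p.2 : unitary B) : B) ψ))).topologicalClosure = ⊤

/-- The local commutant `C_ψ(D,T)`. -/
def localCommutant (D T : unitary B) (ψ : H) : Set B :=
  {V : B | ∀ n l : ℤ,
    V (((D ^ n : unitary B) : B) (((T ^ l : unitary B) : B) ψ)) =
      ((D ^ n : unitary B) : B) (((T ^ l : unitary B) : B) (V ψ))}

/-- The core space `V₀^ψ`: the closed linear span of `{DⁿTˡψ : n < 0, l ∈ ℤ}`. -/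
def coreSpace (D T : unitary B) (ψ : H) : Submodule ℂ H :=
  (Submodule.span ℂ {x : H | ∃ n l : ℤ, n < 0 ∧
    x = ((D ^ n : unitary B) : B) (((T ^ l : unitary B) : B) ψ)}).topologicalClosure

/-- Two wavelets `ψ, η` are core equivalent if there is a unitary
`S : V₀^ψ → V₀^η` intertwining the translation `T`: `S(Tx) = T(Sx)`. -/
def CoreEquivalent (D T : unitary B) (ψ η : H) : Prop :=
  ∃ S : (coreSpace D T ψ) ≃ₗᵢ[ℂ] (coreSpace D T η),
    ∀ x y : coreSpace D T ψ, (y : H) = (T : B) (x : H) →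
      ((S y : H) = (T : B) (S x : H))

/-- A continuous linear map sending `S` into a closed subspace `K` sends the closed span of `S`
into `K`. -/
theorem mem_of_mem_closedSpan (A : B) (S : Set H) (K : Submodule ℂ H) (hK : IsClosed (K : Set H))
    (h : ∀ s ∈ S, A s ∈ K) {x : H} (hx : x ∈ (Submodule.span ℂ S).topologicalClosure) :
    A x ∈ K := by
  have hle : (Submodule.span ℂ S).topologicalClosure ≤ K.comap (A : H →ₗ[ℂ] H) :=
    Submodule.topologicalClosure_minimal _ (Submodule.span_le.2 h) (hK.preimage A.continuous)
  exact hle hx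

theorem unitary_mul_apply (A C : unitary B) (x : H) :
    ((A * C : unitary B) : B) x = (A : B) ((C : B) x) := rfl

theorem unitary_inner_apply (A : unitary B) (x y : H) :
    inner ℂ ((A : B) x) y = inner ℂ x (((A⁻¹ : unitary B) : B) y) :=
  (ContinuousLinearMap.adjoint_inner_right (A : B) x y).symm

theorem unitary_apply_inv_apply (A : unitary B) (x : H) :
    (A : B) (((A⁻¹ : unitary B) : B) x) = x := by
  rw [← unitary_mul_apply, mul_inv_cancel]; rfl

theorem unitary_inner_apply_apply (A : unitary B) (x y : H) :
    inner ℂ ((A : B) x) ((A : B) y) = inner ℂ x y := by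
  rw [unitary_inner_apply, ← unitary_mul_apply, inv_mul_cancel]; rfl

theorem unitary_apply_mem_orthogonal (A : unitary B) (K L : Submodule ℂ H)
    (h : ∀ y ∈ L, ((A⁻¹ : unitary B) : B) y ∈ K) {x : H} (hx : x ∈ Kᗮ) : (A : B) x ∈ Lᗮ := by
  rw [Submodule.mem_orthogonal'] at hx ⊢
  intro y hy
  rw [unitary_inner_apply]
  exact hx _ (h y hy)

theorem unitary_map_eq (A : unitary B) (K : Submodule ℂ H) (h : ∀ x ∈ K, (A : B) x ∈ K)
    (h' : ∀ x ∈ K, ((A⁻¹ : unitary B) : B) x ∈ K) : K.map ((A : B) : H →ₗ[ℂ] H) = K := by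
  apply le_antisymm
  · rintro _ ⟨x, hx, rfl⟩
    exact h x hx
  · exact fun x hx => ⟨_, h' x hx, unitary_apply_inv_apply A x⟩

theorem unitary_map_eq_and_orthogonal (A : unitary B) (K : Submodule ℂ H)
    (h : ∀ x ∈ K, (A : B) x ∈ K) (h' : ∀ x ∈ K, ((A⁻¹ : unitary B) : B) x ∈ K) :
    K.map ((A : B) : H →ₗ[ℂ] H) = K ∧ Kᗮ.map ((A : B) : H →ₗ[ℂ] H) = Kᗮ :=
  ⟨unitary_map_eq A K h h', unitary_map_eq A Kᗮ
    (fun _ hx => unitary_apply_mem_orthogonal A K K h' hx)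
    (fun _ hx => unitary_apply_mem_orthogonal A⁻¹ K K (by rwa [inv_inv]) hx)⟩

/-- The dilation semiconjugates `T²` to `T`. -/
theorem semiconjBy_dilation (D T : unitary B)
    (hD : ∀ f : H, ⇑((D : B) f) =ᵐ[volume] fun x : ℝ => (Real.sqrt 2 : ℂ) * f (2 * x))
    (hT : ∀ f : H, ⇑((T : B) f) =ᵐ[volume] fun x : ℝ => f (x + 1)) :
    SemiconjBy D (T ^ 2) T := by
  have hmul : Measure.QuasiMeasurePreserving (fun x : ℝ => 2 * x) volume volume :=
    Measure.quasiMeasurePreserving_smul volume (two_ne_zero : (2 : ℝ) ≠ 0)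
  have hadd : Measure.QuasiMeasurePreserving (fun x : ℝ => x + 1) volume volume :=
    (measurePreserving_add_right volume (1 : ℝ)).quasiMeasurePreserving
  apply Subtype.ext
  apply ContinuousLinearMap.ext
  intro f
  rw [sq, unitary_mul_apply, unitary_mul_apply, unitary_mul_apply]
  apply Lp.ext
  filter_upwards [hD ((T : B) ((T : B) f)), hmul.ae (hT ((T : B) f)),
    (hadd.comp hmul).ae (hT f), hT ((D : B) f), hadd.ae (hD f)] with x h₁ h₂ h₃ h₄ h₅
  simp only [Function.comp_apply] at h₃
  rw [h₁, h₂, h₃, h₄, h₅]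
  congr 2
  ring

theorem translation_zpow_mul_dilation_pow (D T : unitary B) (h : SemiconjBy D (T ^ 2) T) (k : ℤ)
    (n : ℕ) : T ^ k * D ^ n = D ^ n * T ^ (2 ^ n * k) := by
  have key : SemiconjBy (D ^ n) (T ^ (2 ^ n)) T := by
    induction n with
    | zero => simp
    | succ n ih =>
      rw [pow_succ' D, pow_succ 2 n, mul_comm, pow_mul]
      refine h.mul_left ?_
      rw [← pow_mul, mul_comm, pow_mul]
      exact ih.pow_right 2
  have := (key.zpow_right k).eq
  rw [← zpow_natCast T, ← zpow_mul] at this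
  exact_mod_cast this.symm

theorem mem_coreSpace (D T : unitary B) (ψ : H) {n : ℤ} (hn : n < 0) (l : ℤ) :
    ((D ^ n : unitary B) : B) (((T ^ l : unitary B) : B) ψ) ∈ coreSpace D T ψ :=
  Submodule.le_topologicalClosure _ (Submodule.subset_span ⟨n, l, hn, rfl⟩)

theorem inner_eq_zero_of_mem_closedSpan (S : Set H) (y : H) (h : ∀ s ∈ S, inner ℂ s y = 0)
    {x : H} (hx : x ∈ (Submodule.span ℂ S).topologicalClosure) : inner ℂ x y = 0 := by
  have hle : (Submodule.span ℂ S).topologicalClosure ≤ (ℂ ∙ y)ᗮ :=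
    Submodule.topologicalClosure_minimal _
      (Submodule.span_le.2 fun s hs => Submodule.mem_orthogonal_singleton_iff_inner_left.2 (h s hs))
      (Submodule.isClosed_orthogonal _)
  exact Submodule.mem_orthogonal_singleton_iff_inner_left.1 (hle hx)

/-- The orthogonal complement of the core space of a wavelet is the closed span of the
nonnegative dilates. -/
theorem orthogonal_coreSpace (D T : unitary B) (ψ : H) (hψ : IsWavelet D T ψ) :
    (coreSpace D T ψ)ᗮ = (Submodule.span ℂ {x : H | ∃ (n : ℕ) (l : ℤ),
      x = ((D ^ n : unitary B) : B) (((T ^ l : unitary B) : B) ψ)}).topologicalClosure := by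
  set S : Set H := {x : H | ∃ (n : ℕ) (l : ℤ),
      x = ((D ^ n : unitary B) : B) (((T ^ l : unitary B) : B) ψ)}
  set W := (Submodule.span ℂ S).topologicalClosure
  have hmem : ∀ (n : ℕ) (l : ℤ), ((D ^ n : unitary B) : B) (((T ^ l : unitary B) : B) ψ) ∈ W :=
    fun n l => Submodule.le_topologicalClosure _ (Submodule.subset_span ⟨n, l, rfl⟩)
  have hcomplete : CompleteSpace W :=
    (Submodule.isClosed_topologicalClosure (Submodule.span ℂ S)).completeSpace_coe
  have hle : W ≤ (coreSpace D T ψ)ᗮ := by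
    refine Submodule.topologicalClosure_minimal _ (Submodule.span_le.2 ?_)
      (Submodule.isClosed_orthogonal _)
    rintro _ ⟨n, l, rfl⟩
    refine (Submodule.mem_orthogonal _ _).2 fun y hy => inner_eq_zero_of_mem_closedSpan _ _ ?_ hy
    rintro _ ⟨m, k, hm, rfl⟩
    have hne : (m, k) ≠ ((n : ℤ), l) := fun he => by
      have := congrArg Prod.fst he
      dsimp only at this
      omega
    simpa using hψ.1.2 hne
  have hbot : Wᗮ ⊓ (coreSpace D T ψ)ᗮ = ⊥ := by
    refine (Submodule.eq_bot_iff _).2 fun x hx => ?_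
    rw [← inner_self_eq_zero (𝕜 := ℂ)]
    refine inner_eq_zero_of_mem_closedSpan _ x ?_ (hψ.2.symm ▸ Submodule.mem_top)
    rintro _ ⟨⟨n, l⟩, rfl⟩
    rcases lt_or_ge n 0 with hn | hn
    · exact (Submodule.mem_orthogonal _ _).1 hx.2 _ (mem_coreSpace D T ψ hn l)
    · lift n to ℕ using hn
      simpa using (Submodule.mem_orthogonal _ _).1 hx.1 _ (hmem n l)
  rw [← Submodule.sup_orthogonal_inf_of_hasOrthogonalProjection hle, hbot, sup_bot_eq]

theorem isWavelet_of_mem_localCommutant (D T : unitary B) (ψ : H) (hψ : IsWavelet D T ψ)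
    (V : unitary B) (hV : (V : B) ∈ localCommutant D T ψ) : IsWavelet D T ((V : B) ψ) := by
  have hfam : (fun p : ℤ × ℤ => ((D ^ p.1 : unitary B) : B) (((T ^ p.2 : unitary B) : B)
      ((V : B) ψ))) = fun p : ℤ × ℤ =>
      (V : B) (((D ^ p.1 : unitary B) : B) (((T ^ p.2 : unitary B) : B) ψ)) :=
    funext fun p => (hV p.1 p.2).symm
  unfold IsWavelet
  rw [hfam]
  refine ⟨?_, ?_⟩
  · rw [orthonormal_iff_ite]
    intro p q
    rw [unitary_inner_apply_apply]
    exact orthonormal_iff_ite.1 hψ.1 p q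
  · rw [eq_top_iff]
    intro x _
    rw [← unitary_apply_inv_apply V x]
    refine mem_of_mem_closedSpan V _ _ (Submodule.isClosed_topologicalClosure _) ?_
      (hψ.2.symm ▸ Submodule.mem_top)
    rintro _ ⟨p, rfl⟩
    exact Submodule.le_topologicalClosure _ (Submodule.subset_span ⟨p, rfl⟩)

theorem translation_zpow_apply_mem_orthogonal_coreSpace (D T : unitary B)
    (h : SemiconjBy D (T ^ 2) T) (ψ : H) (hψ : IsWavelet D T ψ) (k : ℤ) {x : H}
    (hx : x ∈ (coreSpace D T ψ)ᗮ) : ((T ^ k : unitary B) : B) x ∈ (coreSpace D T ψ)ᗮ := by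
  rw [orthogonal_coreSpace D T ψ hψ] at hx ⊢
  refine mem_of_mem_closedSpan _ _ _ (Submodule.isClosed_topologicalClosure _) ?_ hx
  rintro _ ⟨n, l, rfl⟩
  refine Submodule.le_topologicalClosure _ (Submodule.subset_span ⟨n, 2 ^ n * k + l, ?_⟩)
  rw [← unitary_mul_apply, translation_zpow_mul_dilation_pow D T h, zpow_add]
  rfl

theorem zpow_apply_mem_coreSpace (D T U : unitary B) (ψ : H)
    (hU : ∀ n : ℤ, ((U ^ n : unitary B) : B) ∈ localCommutant D T ψ) (k i : ℤ) {x : H}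
    (hx : x ∈ coreSpace D T (((U ^ i : unitary B) : B) ψ)) :
    ((U ^ k : unitary B) : B) x ∈ coreSpace D T (((U ^ (k + i) : unitary B) : B) ψ) := by
  refine mem_of_mem_closedSpan _ _ _ (Submodule.isClosed_topologicalClosure _) ?_ hx
  rintro _ ⟨n, l, hn, rfl⟩
  rw [← hU i, ← unitary_mul_apply, ← zpow_add, hU (k + i)]
  exact mem_coreSpace D T _ hn l

/-- With `Y` the closed span of the union of the `(V₀⁽ⁱ⁾)^⊥`: (i) `Y^⊥ ⊆ V₀⁽ⁱ⁾` for every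
`i`; (ii) `U(Y) = Y` and `U(Y^⊥) = Y^⊥`; (iii) `T(Y) = Y` and `T(Y^⊥) = Y^⊥`. -/
theorem stmt_4
    (D T : unitary B)
    (hD : ∀ f : H, ⇑((D : B) f) =ᵐ[MeasureTheory.volume]
      fun x : ℝ => (Real.sqrt 2 : ℂ) * f (2 * x))
    (hT : ∀ f : H, ⇑((T : B) f) =ᵐ[MeasureTheory.volume] fun x : ℝ => f (x + 1))
    (ψ : H) (hψ : IsWavelet D T ψ)
    (U : unitary B)
    (hU : ∀ n : ℤ, ((U ^ n : unitary B) : B) ∈ localCommutant D T ψ)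
    (Y : Submodule ℂ H)
    (hY : Y = (Submodule.span ℂ
      (⋃ i : ℤ, ((coreSpace D T (((U ^ i : unitary B) : B) ψ))ᗮ : Set H))).topologicalClosure) :
    (∀ i : ℤ, Yᗮ ≤ coreSpace D T (((U ^ i : unitary B) : B) ψ)) ∧
    (Y.map ((U : B) : H →ₗ[ℂ] H) = Y ∧ Yᗮ.map ((U : B) : H →ₗ[ℂ] H) = Yᗮ) ∧
    (Y.map ((T : B) : H →ₗ[ℂ] H) = Y ∧ Yᗮ.map ((T : B) : H →ₗ[ℂ] H) = Yᗮ) := by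
  have hclosed : IsClosed (Y : Set H) := hY ▸ Submodule.isClosed_topologicalClosure _
  have hle : ∀ i : ℤ, (coreSpace D T (((U ^ i : unitary B) : B) ψ))ᗮ ≤ Y := fun i x hx =>
    hY ▸ Submodule.le_topologicalClosure _ (Submodule.subset_span (Set.mem_iUnion.2 ⟨i, hx⟩))
  have hmap : ∀ A : unitary B,
      (∀ i : ℤ, ∀ x ∈ (coreSpace D T (((U ^ i : unitary B) : B) ψ))ᗮ, (A : B) x ∈ Y) →
      ∀ x ∈ Y, (A : B) x ∈ Y := by
    intro A hA x hx
    rw [hY] at hx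
    refine mem_of_mem_closedSpan A _ Y hclosed ?_ hx
    intro s hs
    obtain ⟨i, hi⟩ := Set.mem_iUnion.1 hs
    exact hA i s hi
  have hUY : ∀ k : ℤ, ∀ x ∈ Y, ((U ^ k : unitary B) : B) x ∈ Y := by
    refine fun k => hmap _ fun i x hx => hle (k + i) ?_
    refine unitary_apply_mem_orthogonal _ _ _ (fun y hy => ?_) hx
    have := zpow_apply_mem_coreSpace D T U ψ hU (-k) (k + i) hy
    rwa [neg_add_cancel_left, zpow_neg] at this
  have hTY : ∀ k : ℤ, ∀ x ∈ Y, ((T ^ k : unitary B) : B) x ∈ Y := fun k =>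
    hmap _ fun i _ hx => hle i (translation_zpow_apply_mem_orthogonal_coreSpace D T
      (semiconjBy_dilation D T hD hT) _ (isWavelet_of_mem_localCommutant D T ψ hψ _ (hU i)) k hx)
  refine ⟨fun i => ?_, unitary_map_eq_and_orthogonal U Y ?_ ?_,
    unitary_map_eq_and_orthogonal T Y ?_ ?_⟩
  · have h := Submodule.orthogonal_le (hle i)
    rwa [Submodule.orthogonal_orthogonal_eq_closure,
      IsClosed.submodule_topologicalClosure_eq
        (s := coreSpace D T (((U ^ i : unitary B) : B) ψ))
        (Submodule.isClosed_topologicalClosure _)] at h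
  · simpa using hUY 1
  · simpa using hUY (-1)
  · simpa using hTY 1
  · simpa using hTY (-1)

end
end

section
/- If F = {ψ_i : i ∈ I} is an interpolation family of wavelets in L²(ℝ), then any two wavelets in F are core equivalent. -/
open MeasureTheory
open scoped ComplexInnerProductSpace

noncomputable section

lemma translation_mul_dilation (D T : unitary B)
    (hD : ∀ f : H, ⇑((D : B) f) =ᵐ[volume] fun x : ℝ => (Real.sqrt 2 : ℂ) * f (2 * x))
    (hT : ∀ f : H, ⇑((T : B) f) =ᵐ[volume] fun x : ℝ => f (x + 1)) :
    T * D = D * T ^ 2 := by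
  have qT : Measure.QuasiMeasurePreserving (fun x : ℝ => x + 1) volume volume :=
    (measurePreserving_add_right volume (1 : ℝ)).quasiMeasurePreserving
  have qD : Measure.QuasiMeasurePreserving (fun x : ℝ => 2 * x) volume volume := by
    refine ⟨measurable_const_mul 2, ?_⟩
    rw [Real.map_volume_mul_left two_ne_zero]
    exact Measure.smul_absolutelyContinuous
  refine Subtype.ext (ContinuousLinearMap.ext fun f => Lp.ext ?_)
  change ⇑((T : B) ((D : B) f)) =ᵐ[volume] ⇑((D : B) (((T ^ 2 : unitary B) : B) f))
  have e : ((T ^ 2 : unitary B) : B) f = (T : B) ((T : B) f) := by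
    rw [pow_two]; rfl
  rw [e]
  filter_upwards [hT ((D : B) f), qT.ae (hD f), hD ((T : B) ((T : B) f)),
    qD.ae (hT ((T : B) f)), qD.ae (qT.ae (hT f))] with x h1 h2 h3 h4 h5
  rw [h1, h2, h3, h4, h5]
  ring_nf

lemma mul_pow_of_mul_eq {G : Type*} [Group G] {D T : G} (h : T * D = D * T ^ 2) (n : ℕ) :
    T * D ^ n = D ^ n * T ^ (2 ^ n) := by
  have hk (k : ℕ) : T ^ k * D = D * T ^ (2 * k) := by
    rw [pow_mul]
    exact ((show SemiconjBy D (T ^ 2) T from h.symm).pow_right k).eq.symm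
  induction n with
  | zero => simp
  | succ n ih => rw [pow_succ, ← mul_assoc, ih, mul_assoc, hk, mul_assoc, pow_succ' 2]

section Hilbert

variable {E : Type*} [NormedAddCommGroup E] [InnerProductSpace ℂ E]

lemma mem_closure_span_of_mapsTo (G : Set E) (A : E →L[ℂ] E) (h : ∀ g ∈ G, A g ∈ G) {x : E}
    (hx : x ∈ (Submodule.span ℂ G).topologicalClosure) :
    A x ∈ (Submodule.span ℂ G).topologicalClosure := by
  have : (Submodule.span ℂ G).topologicalClosure ≤
      (Submodule.span ℂ G).topologicalClosure.comap A.toLinearMap := by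
    refine Submodule.topologicalClosure_minimal _ (Submodule.span_le.2 fun g hg => ?_)
      ((Submodule.isClosed_topologicalClosure _).preimage A.continuous)
    exact Submodule.le_topologicalClosure _ (Submodule.subset_span (h g hg))
  exact this hx

variable [CompleteSpace E]

lemma inner_unitary_left (V : unitary (E →L[ℂ] E)) (x y : E) :
    inner ℂ ((V : E →L[ℂ] E) x) y = inner ℂ x (((V⁻¹ : unitary (E →L[ℂ] E)) : E →L[ℂ] E) y) := by
  rw [← ContinuousLinearMap.adjoint_inner_right]
  rfl

lemma unitary_mul_apply_s5 (V W : unitary (E →L[ℂ] E)) (x : E) :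
    ((V * W : unitary (E →L[ℂ] E)) : E →L[ℂ] E) x = (V : E →L[ℂ] E) ((W : E →L[ℂ] E) x) := rfl

/-- A unitary preserving a closed subspace along with its inverse commutes with the projection. -/
lemma commute_starProjection (M : Submodule ℂ E) [M.HasOrthogonalProjection]
    (V : unitary (E →L[ℂ] E)) (h1 : ∀ x ∈ M, (V : E →L[ℂ] E) x ∈ M)
    (h2 : ∀ x ∈ M, ((V⁻¹ : unitary (E →L[ℂ] E)) : E →L[ℂ] E) x ∈ M) :
    (V : E →L[ℂ] E) * M.starProjection = M.starProjection * (V : E →L[ℂ] E) := by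
  ext x
  change (V : E →L[ℂ] E) (M.starProjection x) = M.starProjection ((V : E →L[ℂ] E) x)
  symm
  refine Submodule.eq_starProjection_of_mem_of_inner_eq_zero (h1 _ (M.starProjection_apply_mem x))
    fun w hw => ?_
  rw [← map_sub, inner_unitary_left]
  exact M.starProjection_inner_eq_zero x _ (h2 w hw)

/-- If unitaries `U` and `T` commute on a set `G` stable under both and their inverses, then
some unitary commuting with `T` agrees with `U` on `G`. -/
lemma exists_unitary_commute_eqOn (U T : unitary (E →L[ℂ] E)) (G : Set E)
    (hU : ∀ g ∈ G, (U : E →L[ℂ] E) g ∈ G)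
    (hU' : ∀ g ∈ G, ((U⁻¹ : unitary (E →L[ℂ] E)) : E →L[ℂ] E) g ∈ G)
    (hT : ∀ g ∈ G, (T : E →L[ℂ] E) g ∈ G)
    (hT' : ∀ g ∈ G, ((T⁻¹ : unitary (E →L[ℂ] E)) : E →L[ℂ] E) g ∈ G)
    (hc : ∀ g ∈ G, (T : E →L[ℂ] E) ((U : E →L[ℂ] E) g) = (U : E →L[ℂ] E) ((T : E →L[ℂ] E) g)) :
    ∃ W : unitary (E →L[ℂ] E), T * W = W * T ∧
      ∀ g ∈ G, (W : E →L[ℂ] E) g = (U : E →L[ℂ] E) g := by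
  set M := (Submodule.span ℂ G).topologicalClosure with hM
  have : CompleteSpace M := (Submodule.isClosed_topologicalClosure _).completeSpace_coe
  set P : E →L[ℂ] E := M.starProjection with hP
  have hPs : star P = P := isSelfAdjoint_starProjection M
  have hPP : P * P = P := M.isIdempotentElem_starProjection
  have hUP : (U : E →L[ℂ] E) * P = P * (U : E →L[ℂ] E) :=
    commute_starProjection M U (fun x hx => mem_closure_span_of_mapsTo G _ hU hx)
      fun x hx => mem_closure_span_of_mapsTo G _ hU' hx
  have hTP : (T : E →L[ℂ] E) * P = P * (T : E →L[ℂ] E) :=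
    commute_starProjection M T (fun x hx => mem_closure_span_of_mapsTo G _ hT hx)
      fun x hx => mem_closure_span_of_mapsTo G _ hT' hx
  have hUP' : star (U : E →L[ℂ] E) * P = P * star (U : E →L[ℂ] E) := by
    have := congrArg star hUP
    rw [star_mul, star_mul, hPs] at this
    exact this.symm
  have hTUP : (T : E →L[ℂ] E) * (U : E →L[ℂ] E) * P = (U : E →L[ℂ] E) * (T : E →L[ℂ] E) * P := by
    have hle : M ≤ LinearMap.eqLocus ((T : E →L[ℂ] E) * (U : E →L[ℂ] E)).toLinearMap
        ((U : E →L[ℂ] E) * (T : E →L[ℂ] E)).toLinearMap :=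
      Submodule.topologicalClosure_minimal _ (Submodule.span_le.2 hc)
        (isClosed_eq ((T : E →L[ℂ] E) * (U : E →L[ℂ] E)).continuous
          ((U : E →L[ℂ] E) * (T : E →L[ℂ] E)).continuous)
    ext x
    exact hle (M.starProjection_apply_mem x)
  have hU1 : star (U : E →L[ℂ] E) * (U : E →L[ℂ] E) = 1 := Unitary.coe_star_mul_self U
  have hU2 : (U : E →L[ℂ] E) * star (U : E →L[ℂ] E) = 1 := Unitary.coe_mul_star_self U
  have hstar : star ((U : E →L[ℂ] E) * P + (1 - P)) = star (U : E →L[ℂ] E) * P + (1 - P) := by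
    rw [star_add, star_mul, star_sub, star_one, hPs, hUP']
  have hunit (A A' : E →L[ℂ] E) (hA : A * P = P * A) (hA' : A' * A = 1) :
      (A' * P + (1 - P)) * (A * P + (1 - P)) = 1 := by
    have e1 : A' * P * (A * P) = P := by
      rw [hA, mul_assoc, ← mul_assoc P P, hPP, ← hA, ← mul_assoc, hA', one_mul]
    have e2 : A' * P * (1 - P) = 0 := by rw [mul_sub, mul_one, mul_assoc, hPP, sub_self]
    have e3 : (1 - P) * (A * P) = 0 := by
      rw [hA, ← mul_assoc, sub_mul, one_mul, hPP, sub_self, zero_mul]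
    have e4 : (1 - P) * (1 - P) = 1 - P := by
      rw [sub_mul, one_mul, mul_sub, mul_one, hPP, sub_self, sub_zero]
    rw [add_mul, mul_add, mul_add, e1, e2, e3, e4, add_zero, zero_add, add_sub_cancel]
  refine ⟨⟨(U : E →L[ℂ] E) * P + (1 - P), Unitary.mem_iff.2 ⟨?_, ?_⟩⟩, ?_, ?_⟩
  · rw [hstar]
    exact hunit _ _ hUP hU1
  · rw [hstar]
    exact hunit _ _ hUP' hU2
  · refine Subtype.ext ?_
    change (T : E →L[ℂ] E) * ((U : E →L[ℂ] E) * P + (1 - P)) =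
      ((U : E →L[ℂ] E) * P + (1 - P)) * (T : E →L[ℂ] E)
    rw [mul_add, add_mul, ← mul_assoc, hTUP, mul_assoc _ _ P, hTP, mul_sub, sub_mul, hTP,
      mul_one, one_mul, mul_assoc]
  · intro g hg
    have : P g = g := Submodule.starProjection_eq_self_iff.2
      (Submodule.le_topologicalClosure _ (Submodule.subset_span hg))
    change (U : E →L[ℂ] E) (P g) + (g - P g) = _
    rw [this, sub_self, add_zero]

end Hilbert

/-- The core space is the orthogonal complement of the nonnegative scales. -/
lemma mem_coreSpace_iff {D T : unitary B} {ψ : H} (hw : IsWavelet D T ψ) (x : H) :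
    x ∈ coreSpace D T ψ ↔ ∀ (n : ℕ) (l : ℤ),
      inner ℂ (((D ^ n : unitary B) : B) (((T ^ l : unitary B) : B) ψ)) x = 0 := by
  obtain ⟨ho, hs⟩ := hw
  have : CompleteSpace (coreSpace D T ψ) :=
    (Submodule.isClosed_topologicalClosure _).completeSpace_coe
  have hle : ∀ y ∈ coreSpace D T ψ, ∀ (n : ℕ) (l : ℤ),
      inner ℂ (((D ^ n : unitary B) : B) (((T ^ l : unitary B) : B) ψ)) y = 0 := by
    intro y hy n l
    have h : coreSpace D T ψ ≤ LinearMap.ker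
        (innerSL ℂ (((D ^ n : unitary B) : B) (((T ^ l : unitary B) : B) ψ))).toLinearMap := by
      refine Submodule.topologicalClosure_minimal _ (Submodule.span_le.2 ?_)
        (ContinuousLinearMap.isClosed_ker _)
      rintro _ ⟨m, k, hm, rfl⟩
      have hne : ((n : ℤ), l) ≠ (m, k) := fun h => by
        have := congrArg Prod.fst h
        simp only at this
        omega
      have := ho.2 hne
      simp only [zpow_natCast] at this
      exact this
    exact h hy
  refine ⟨fun hx => hle x hx, fun hx => ?_⟩
  set y := (coreSpace D T ψ).starProjection x with hy
  have hym : y ∈ coreSpace D T ψ := Submodule.starProjection_apply_mem _ _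
  suffices h0 : x - y = 0 by rw [sub_eq_zero.1 h0]; exact hym
  have hort : x - y ∈ (Submodule.span ℂ (Set.range fun p : ℤ × ℤ =>
      ((D ^ p.1 : unitary B) : B) (((T ^ p.2 : unitary B) : B) ψ))).topologicalClosureᗮ := by
    rw [Submodule.orthogonal_closure, Submodule.mem_orthogonal]
    intro u hu
    induction hu using Submodule.span_induction with
    | mem u hu =>
      obtain ⟨⟨n, l⟩, rfl⟩ := hu
      rcases lt_or_ge n 0 with hn | hn
      · rw [inner_eq_zero_symm]
        exact Submodule.starProjection_inner_eq_zero x _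
          (Submodule.le_topologicalClosure _ (Submodule.subset_span ⟨n, l, hn, rfl⟩))
      · lift n to ℕ using hn
        simp only [zpow_natCast]
        rw [inner_sub_right, hx n l, hle y hym n l, sub_zero]
    | zero => exact inner_zero_left _
    | add u v _ _ hu hv => rw [inner_add_left, hu, hv, add_zero]
    | smul c u _ hu => rw [inner_smul_left, hu, mul_zero]
  rwa [hs, Submodule.top_orthogonal_eq_bot, Submodule.mem_bot] at hort

/-- A unitary commuting with `T` and matching nonnegative scales gives a core equivalence. -/
lemma coreEquivalent_of_unitary {D T : unitary B} {ψ η : H} (hψ : IsWavelet D T ψ)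
    (hη : IsWavelet D T η) (W : unitary B) (hc : T * W = W * T)
    (hW : ∀ (n : ℕ) (l : ℤ),
      (W : B) (((D ^ n : unitary B) : B) (((T ^ l : unitary B) : B) ψ)) =
        ((D ^ n : unitary B) : B) (((T ^ l : unitary B) : B) η)) :
    CoreEquivalent D T ψ η := by
  let e : H ≃ₗᵢ[ℂ] H := Unitary.linearIsometryEquiv W
  have he (x : H) : e x = (W : B) x := rfl
  have hmem (x : H) : e x ∈ coreSpace D T η ↔ x ∈ coreSpace D T ψ := by
    simp only [mem_coreSpace_iff hψ, mem_coreSpace_iff hη, ← hW, ← he,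
      LinearIsometryEquiv.inner_map_map]
  have hmap : (coreSpace D T ψ).map e.toLinearEquiv.toLinearMap = coreSpace D T η := by
    ext y
    constructor
    · rintro ⟨x, hx, rfl⟩
      exact (hmem x).2 hx
    · intro hy
      refine ⟨e.symm y, (hmem _).1 ?_, e.apply_symm_apply y⟩
      rwa [e.apply_symm_apply]
  refine ⟨⟨e.toLinearEquiv.ofSubmodules _ _ hmap, fun x => e.norm_map x⟩, fun x y hxy => ?_⟩
  change (W : B) (y : H) = (T : B) ((W : B) (x : H))
  rw [hxy, ← unitary_mul_apply_s5, ← hc, unitary_mul_apply_s5]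

/-- All wavelets in an interpolation family are pairwise core equivalent. -/
theorem stmt_5
    (D T : unitary B)
    (hD : ∀ f : H, ⇑((D : B) f) =ᵐ[MeasureTheory.volume]
      fun x : ℝ => (Real.sqrt 2 : ℂ) * f (2 * x))
    (hT : ∀ f : H, ⇑((T : B) f) =ᵐ[MeasureTheory.volume] fun x : ℝ => f (x + 1))
    {I : Type*} (ψ : I → H) (hw : ∀ i : I, IsWavelet D T (ψ i))
    (hfam : ∀ i j : I, ∃ U : unitary B,
      (U : B) (ψ i) = ψ j ∧
      (∀ n : ℤ, ((U ^ n : unitary B) : B) ∈ localCommutant D T (ψ i)) ∧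
      (∀ n : ℤ, ∃ k : I, ((U ^ n : unitary B) : B) (ψ i) = ψ k)) :
    ∀ i j : I, CoreEquivalent D T (ψ i) (ψ j) := by
  intro i j
  obtain ⟨U, hUψ, hUc, -⟩ := hfam i j
  have hTD := mul_pow_of_mul_eq (translation_mul_dilation D T hD hT)
  let v (k : ℤ) (n : ℕ) (l : ℤ) : H :=
    ((U ^ k : unitary B) : B) (((D ^ n : unitary B) : B) (((T ^ l : unitary B) : B) (ψ i)))
  have hv (k : ℤ) (n : ℕ) (l : ℤ) : v k n l =
      ((D ^ n : unitary B) : B) (((T ^ l : unitary B) : B) (((U ^ k : unitary B) : B) (ψ i))) := by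
    simpa only [zpow_natCast] using hUc k n l
  have hUv (k : ℤ) (n : ℕ) (l : ℤ) : (U : B) (v k n l) = v (k + 1) n l := by
    simp only [v, ← unitary_mul_apply_s5, ← mul_assoc, add_comm k, zpow_one_add]
  have hTv (k : ℤ) (n : ℕ) (l : ℤ) : (T : B) (v k n l) = v k n (2 ^ n + l) := by
    have h : T * (D ^ n * T ^ l) = D ^ n * T ^ ((2 : ℤ) ^ n + l) := by
      rw [← mul_assoc, hTD, mul_assoc, zpow_add]
      norm_cast
    simp only [hv, ← unitary_mul_apply_s5, ← mul_assoc]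
    rw [← h, mul_assoc T]
  have hcancel (V : unitary B) {x y : H} (h : (V : B) x = y) :
      ((V⁻¹ : unitary B) : B) y = x := by
    rw [← h, ← unitary_mul_apply_s5, inv_mul_cancel]
    rfl
  let G : Set H := {x | ∃ k n l, x = v k n l}
  obtain ⟨W, hWT, hWU⟩ := exists_unitary_commute_eqOn U T G
    (by rintro _ ⟨k, n, l, rfl⟩; exact ⟨_, _, _, hUv k n l⟩)
    (by
      rintro _ ⟨k, n, l, rfl⟩
      refine ⟨k - 1, n, l, hcancel U ?_⟩
      rw [hUv, sub_add_cancel])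
    (by rintro _ ⟨k, n, l, rfl⟩; exact ⟨_, _, _, hTv k n l⟩)
    (by
      rintro _ ⟨k, n, l, rfl⟩
      refine ⟨k, n, l - 2 ^ n, hcancel T ?_⟩
      rw [hTv, add_sub_cancel])
    (by rintro _ ⟨k, n, l, rfl⟩; rw [hUv, hTv, hTv, hUv])
  refine coreEquivalent_of_unitary (hw i) (hw j) W hWT fun n l => ?_
  have h0 : ((D ^ n : unitary B) : B) (((T ^ l : unitary B) : B) (ψ i)) = v 0 n l := by
    simp only [v, zpow_zero]
    rfl
  rw [h0, hWU _ ⟨0, n, l, rfl⟩, hUv, hv, zero_add, zpow_one, hUψ]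

end
end
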